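/- Let γ, δ₁, δ₂ be positive integers and let Π be the transition operator of the restricted immediate exchange model RIEM(γ,δ₁;γ,δ₂). Then for every α ∈ {+, −, 0}, every f : ℕ² → ℝ, and every (n₁,n₂) with n₁ ≤ γ+δ₁ and n₂ ≤ γ+δ₂, one has (Π((J^{α,γ+δ₁}_1 + J^{α,γ+δ₂}_2)f))(n₁,n₂) = ((J^{α,γ+δ₁}_1 + J^{α,γ+δ₂}_2)(Πf))(n₁,n₂), where on the right-hand side any term whose coefficient vanishes (e.g. the term (γ+δ₁−n₁)·(Πf)(n₁+1,n₂) when n₁ = γ+δ₁) is omitted, so that Πf is only evaluated at points within the capacities. -/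

import Mathlib

/-- Index set for the three generators of (a discrete representation of) SU(2). -/
inductive SUIdx : Type
  | plus
  | minus
  | zero

/-- The operators `J^{+,γ}`, `J^{-,γ}`, `J^{0,γ}` acting on functions `ℕ → ℝ`. -/
noncomputable def Jop : SUIdx → ℕ → (ℕ → ℝ) → ℕ → ℝ
  | .plus, γ, f, n => ((γ : ℝ) - n) * f (n + 1)
  | .minus, _, f, n => (n : ℝ) * f (n - 1)
  | .zero, γ, f, n => ((γ : ℝ) / 2 - n) * f n

/-- `J^{α,γ}` acting on the first variable of a two-variable function. -/
noncomputable def J1 (α : SUIdx) (γ : ℕ) (f : ℕ × ℕ → ℝ) : ℕ × ℕ → ℝ :=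
  fun p => Jop α γ (fun x => f (x, p.2)) p.1

/-- `J^{α,γ}` acting on the second variable of a two-variable function. -/
noncomputable def J2 (α : SUIdx) (γ : ℕ) (f : ℕ × ℕ → ℝ) : ℕ × ℕ → ℝ :=
  fun p => Jop α γ (fun y => f (p.1, y)) p.2

/-- The hypergeometric weight `hyp(k;n,γ,δ) = C(γ,k)·C(δ,n-k)/C(γ+δ,n)`
(binomial coefficients vanish when the lower index exceeds the upper one). -/
noncomputable def hypW (k n γ δ : ℕ) : ℝ :=
  (γ.choose k : ℝ) * (δ.choose (n - k) : ℝ) / ((γ + δ).choose n : ℝ)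

/-- The transition operator of the restricted immediate exchange model RIEM(γ,δ₁;γ,δ₂):
`(Πf)(n₁,n₂) = ∑_{k₁=0}^{n₁} ∑_{k₂=0}^{n₂} hyp(k₁;n₁,γ,δ₁)·hyp(k₂;n₂,γ,δ₂)·f(k₂+n₁-k₁, k₁+n₂-k₂)`. -/
noncomputable def PiRIEM (γ δ₁ δ₂ : ℕ) (f : ℕ × ℕ → ℝ) : ℕ × ℕ → ℝ := fun p =>
  ∑ k₁ ∈ Finset.range (p.1 + 1), ∑ k₂ ∈ Finset.range (p.2 + 1),
    hypW k₁ p.1 γ δ₁ * hypW k₂ p.2 γ δ₂ * f (k₂ + p.1 - k₁, k₁ + p.2 - k₂)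

noncomputable def Lam (γ δ n : ℕ) (F : ℕ → ℕ → ℝ) : ℝ :=
  ∑ p ∈ Finset.HasAntidiagonal.antidiagonal n,
    (γ.choose p.1 : ℝ) * (δ.choose p.2 : ℝ) / ((γ + δ).choose n : ℝ) * F p.1 p.2

lemma choose_step (n k : ℕ) :
    ((k : ℝ) + 1) * (n.choose (k + 1) : ℝ) = ((n : ℝ) - k) * (n.choose k : ℝ) := by
  rcases le_or_gt k n with h | h
  · have := Nat.choose_succ_right_eq n k
    have h2 : ((n.choose (k + 1) * (k + 1) : ℕ) : ℝ) = ((n.choose k * (n - k) : ℕ) : ℝ) := by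
      rw [this]
    push_cast [Nat.cast_sub h] at h2
    linarith
  · rw [Nat.choose_eq_zero_of_lt h, Nat.choose_eq_zero_of_lt (by omega)]; simp

lemma sum_split (n : ℕ) (A : ℕ × ℕ → ℝ) :
    ∑ p ∈ Finset.HasAntidiagonal.antidiagonal (n + 1), ((n : ℝ) + 1) * A p =
      ∑ p ∈ Finset.HasAntidiagonal.antidiagonal n,
        (((p.1 : ℝ) + 1) * A (p.1 + 1, p.2) + ((p.2 : ℝ) + 1) * A (p.1, p.2 + 1)) := by
  have h : ∑ p ∈ Finset.HasAntidiagonal.antidiagonal (n + 1), ((n : ℝ) + 1) * A p =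
      ∑ p ∈ Finset.HasAntidiagonal.antidiagonal (n + 1), (p.1 : ℝ) * A p +
      ∑ p ∈ Finset.HasAntidiagonal.antidiagonal (n + 1), (p.2 : ℝ) * A p := by
    rw [← Finset.sum_add_distrib]
    refine Finset.sum_congr rfl fun p hp => ?_
    have := Finset.HasAntidiagonal.mem_antidiagonal.1 hp
    have h3 : (p.1 : ℝ) + p.2 = n + 1 := by exact_mod_cast this
    rw [← h3]; ring
  rw [h, Finset.Nat.sum_antidiagonal_succ, Finset.Nat.sum_antidiagonal_succ',
    Finset.sum_add_distrib]
  simp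

lemma sum_split_gen (n : ℕ) (B C : ℕ × ℕ → ℝ) :
    ∑ p ∈ Finset.HasAntidiagonal.antidiagonal (n + 1), ((p.1 : ℝ) * B p + (p.2 : ℝ) * C p) =
      ∑ p ∈ Finset.HasAntidiagonal.antidiagonal n,
        (((p.1 : ℝ) + 1) * B (p.1 + 1, p.2) + ((p.2 : ℝ) + 1) * C (p.1, p.2 + 1)) := by
  rw [Finset.sum_add_distrib, Finset.Nat.sum_antidiagonal_succ,
    Finset.Nat.sum_antidiagonal_succ', Finset.sum_add_distrib]
  simp

lemma Lam_Jop (α : SUIdx) (γ δ n : ℕ) (hn : n ≤ γ + δ) (F : ℕ → ℕ → ℝ) :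
    Jop α (γ + δ) (fun m => Lam γ δ m F) n =
      Lam γ δ n (fun i j => Jop α γ (fun x => F x j) i + Jop α δ (fun y => F i y) j) := by
  cases α with
  | plus =>
    simp only [Jop, Lam]
    have hc := choose_step (γ + δ) n
    have hpos : ((γ + δ).choose n : ℝ) ≠ 0 := by
      exact_mod_cast (Nat.choose_pos hn).ne'
    have e : (((γ + δ : ℕ) : ℝ) - n) * ∑ p ∈ Finset.HasAntidiagonal.antidiagonal (n + 1),
        (γ.choose p.1 : ℝ) * (δ.choose p.2 : ℝ) / ((γ + δ).choose (n + 1) : ℝ) * F p.1 p.2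
        = ∑ p ∈ Finset.HasAntidiagonal.antidiagonal (n + 1), ((n : ℝ) + 1) *
          ((γ.choose p.1 : ℝ) * (δ.choose p.2 : ℝ) / ((γ + δ).choose n : ℝ) * F p.1 p.2) := by
      rw [Finset.mul_sum]
      refine Finset.sum_congr rfl fun p hp => ?_
      have hp := Finset.HasAntidiagonal.mem_antidiagonal.1 hp
      rcases hn.lt_or_eq with h | h
      · have hpos' : ((γ + δ).choose (n + 1) : ℝ) ≠ 0 := by
          exact_mod_cast (Nat.choose_pos h).ne'
        field_simp
        linear_combination (-(γ.choose p.1 : ℝ) * (δ.choose p.2 : ℝ) * F p.1 p.2) * hc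
      · have : (γ.choose p.1 : ℝ) * (δ.choose p.2 : ℝ) = 0 := by
          rcases lt_or_ge γ p.1 with h' | h'
          · rw [Nat.choose_eq_zero_of_lt h']; simp
          · rw [Nat.choose_eq_zero_of_lt (show δ < p.2 by omega)]; simp
        rw [this]; simp
    rw [e, sum_split n (fun p => (γ.choose p.1 : ℝ) * (δ.choose p.2 : ℝ) /
      ((γ + δ).choose n : ℝ) * F p.1 p.2)]
    refine Finset.sum_congr rfl fun p hp => ?_
    have h1 := choose_step γ p.1
    have h2 := choose_step δ p.2
    dsimp only
    linear_combination ((δ.choose p.2 : ℝ) / ((γ + δ).choose n : ℝ) * F (p.1 + 1) p.2) * h1 +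
      ((γ.choose p.1 : ℝ) / ((γ + δ).choose n : ℝ) * F p.1 (p.2 + 1)) * h2
  | minus =>
    cases n with
    | zero => simp [Jop, Lam]
    | succ n =>
      simp only [Jop, Lam]
      have e : ∀ p : ℕ × ℕ, (γ.choose p.1 : ℝ) * (δ.choose p.2 : ℝ) /
          ((γ + δ).choose (n + 1) : ℝ) *
          ((p.1 : ℝ) * F (p.1 - 1) p.2 + (p.2 : ℝ) * F p.1 (p.2 - 1)) =
          (p.1 : ℝ) * ((γ.choose p.1 : ℝ) * (δ.choose p.2 : ℝ) /
            ((γ + δ).choose (n + 1) : ℝ) * F (p.1 - 1) p.2) +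
          (p.2 : ℝ) * ((γ.choose p.1 : ℝ) * (δ.choose p.2 : ℝ) /
            ((γ + δ).choose (n + 1) : ℝ) * F p.1 (p.2 - 1)) := fun p => by ring
      simp only [e]
      rw [sum_split_gen n (fun p => (γ.choose p.1 : ℝ) * (δ.choose p.2 : ℝ) /
            ((γ + δ).choose (n + 1) : ℝ) * F (p.1 - 1) p.2)
          (fun p => (γ.choose p.1 : ℝ) * (δ.choose p.2 : ℝ) /
            ((γ + δ).choose (n + 1) : ℝ) * F p.1 (p.2 - 1)), Finset.mul_sum]
      refine Finset.sum_congr rfl fun p hp => ?_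
      have hp := Finset.HasAntidiagonal.mem_antidiagonal.1 hp
      have hp' : (p.1 : ℝ) + p.2 = n := by exact_mod_cast hp
      have h1 := choose_step γ p.1
      have h2 := choose_step δ p.2
      have hc := choose_step (γ + δ) n
      have hpos : ((γ + δ).choose n : ℝ) ≠ 0 := by
        exact_mod_cast (Nat.choose_pos (show n ≤ γ + δ by omega)).ne'
      have hpos' : ((γ + δ).choose (n + 1) : ℝ) ≠ 0 := by
        exact_mod_cast (Nat.choose_pos hn).ne'
      simp only [Nat.add_sub_cancel]
      push_cast at hc ⊢
      rw [← hp'] at hc ⊢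
      field_simp
      linear_combination ((γ.choose p.1 : ℝ) * (δ.choose p.2 : ℝ) * F p.1 p.2) * hc -
        ((δ.choose p.2 : ℝ) * ((γ + δ).choose n : ℝ) * F p.1 p.2) * h1 -
        ((γ.choose p.1 : ℝ) * ((γ + δ).choose n : ℝ) * F p.1 p.2) * h2
  | zero =>
    simp only [Jop, Lam, Finset.mul_sum]
    refine Finset.sum_congr rfl fun p hp => ?_
    have hp := Finset.HasAntidiagonal.mem_antidiagonal.1 hp
    have hp' : (p.1 : ℝ) + p.2 = n := by exact_mod_cast hp
    rw [← hp']
    push_cast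
    ring

lemma Lam_add (γ δ n : ℕ) (F G : ℕ → ℕ → ℝ) :
    Lam γ δ n (fun i j => F i j + G i j) = Lam γ δ n F + Lam γ δ n G := by
  simp only [Lam, mul_add, Finset.sum_add_distrib]

lemma Jop_Lam (α : SUIdx) (c i γ δ n : ℕ) (F : ℕ → ℕ → ℕ → ℝ) :
    Jop α c (fun x => Lam γ δ n (F x)) i =
      Lam γ δ n (fun k l => Jop α c (fun x => F x k l) i) := by
  cases α <;> simp only [Jop, Lam, Finset.mul_sum] <;>
    exact Finset.sum_congr rfl fun p hp => by ring

lemma Jop_shift (α : SUIdx) (γ δ k m : ℕ) (g : ℕ → ℝ) :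
    Jop α (γ + δ) g (k + m) =
      Jop α γ (fun x => g (x + m)) k + Jop α δ (fun x => g (k + x)) m := by
  cases α with
  | plus =>
    simp only [Jop]
    rw [show k + 1 + m = k + m + 1 by ring, ← add_assoc]
    push_cast; ring
  | minus =>
    simp only [Jop]
    rcases k with _ | k <;> rcases m with _ | m
    · simp
    · simp
    · simp
    · rw [show k + 1 + (m + 1) - 1 = k + m + 1 by omega,
        show k + 1 - 1 + (m + 1) = k + m + 1 by omega,
        show k + 1 + (m + 1 - 1) = k + m + 1 by omega]
      push_cast; ring
  | zero => simp only [Jop]; push_cast; ring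

lemma Pi_eq (γ δ₁ δ₂ : ℕ) (f : ℕ × ℕ → ℝ) (n₁ n₂ : ℕ) :
    PiRIEM γ δ₁ δ₂ f (n₁, n₂) = Lam γ δ₁ n₁ (fun k₁ m₁ => Lam γ δ₂ n₂ (fun k₂ m₂ =>
      f (k₂ + m₁, k₁ + m₂))) := by
  simp only [PiRIEM, Lam, hypW]
  rw [Finset.Nat.sum_antidiagonal_eq_sum_range_succ_mk]
  refine Finset.sum_congr rfl fun a ha => ?_
  rw [Finset.Nat.sum_antidiagonal_eq_sum_range_succ_mk, Finset.mul_sum]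
  refine Finset.sum_congr rfl fun b hb => ?_
  have ha := Finset.mem_range.1 ha
  have hb := Finset.mem_range.1 hb
  dsimp only
  rw [Nat.add_sub_assoc (by omega), Nat.add_sub_assoc (by omega)]
  ring

/-- For positive integers `γ, δ₁, δ₂`, the transition operator of RIEM(γ,δ₁;γ,δ₂) commutes
with `J^{α,γ+δ₁}_1 + J^{α,γ+δ₂}_2` for each `α ∈ {+,-,0}`, at every point `(n₁,n₂)` with
`n₁ ≤ γ+δ₁` and `n₂ ≤ γ+δ₂` (terms with vanishing coefficient are harmless since they are
multiplied by `0`). -/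
theorem RIEM_commutes_with_J (γ δ₁ δ₂ : ℕ) (hγ : 0 < γ) (hδ₁ : 0 < δ₁) (hδ₂ : 0 < δ₂)
    (α : SUIdx) (f : ℕ × ℕ → ℝ) (n₁ n₂ : ℕ) (h₁ : n₁ ≤ γ + δ₁) (h₂ : n₂ ≤ γ + δ₂) :
    PiRIEM γ δ₁ δ₂ (fun p => J1 α (γ + δ₁) f p + J2 α (γ + δ₂) f p) (n₁, n₂)
      = J1 α (γ + δ₁) (PiRIEM γ δ₁ δ₂ f) (n₁, n₂)
        + J2 α (γ + δ₂) (PiRIEM γ δ₁ δ₂ f) (n₁, n₂) := by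
  have hL2 := fun (F : ℕ → ℕ → ℝ) => Lam_Jop α γ δ₂ n₂ h₂ F
  have hL1 := fun (F : ℕ → ℕ → ℝ) => Lam_Jop α γ δ₁ n₁ h₁ F
  simp only [J1, J2, Pi_eq, Jop_shift]
  rw [hL1, Jop_Lam]
  simp only [hL2, Jop_Lam, Lam_add]
  ring
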